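/- Suppose (G,p) is a framework on a family of concentric cylinders Y with rank R_Y(G,p) = 3n − 2, and (ω,λ) is an equilibrium stress for (G,p) on Y with rank Ω_Y(ω,λ) = 3n − 6. Let G' = (V',E') be a 1-extension of G (so |V'| = n+1) and let q : V' → ℝ³ be such that q is a generic point of ℝ^{3(n+1)}. Then rank R_{Y^q}(G',q) = 3(n+1) − 2, and (G',q) has an equilibrium stress (ω',λ') on Y^q with rank Ω_{Y^q}(ω',λ') = 3(n+1) − 6. -/

import Mathlib

open Finset

/-- The rigidity matrix `R_Y(G,p)` of a framework on a family of concentric cylinders: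
rows indexed by (potential) edges and by vertices, columns by `Fin 3 × Fin n`
(coordinate block × vertex).  The row of an edge `v_iv_j` carries `p_i − p_j` in the
columns of `v_i` and `p_j − p_i` in the columns of `v_j`; the row of a vertex `v_i`
carries `(x_i, y_i, 0)` in the columns of `v_i`.  Rows indexed by non-edges are zero. -/
def rigidityMatY {n : ℕ} (G : SimpleGraph (Fin n)) [DecidableRel G.Adj]
    (p : Fin n → Fin 3 → ℝ) : Matrix (Sym2 (Fin n) ⊕ Fin n) (Fin 3 × Fin n) ℝ :=
  fun row c =>
    match row with
    | Sum.inl e =>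
        if e ∈ G.edgeSet then
          if h : c.2 ∈ e then p c.2 c.1 - p (Sym2.Mem.other' h) c.1 else 0
        else 0
    | Sum.inr i => if c.2 = i ∧ c.1 ≠ 2 then p i c.1 else 0

/-- The `n×n` matrix `Ω(ω)` with off-diagonal entries `-ω i j` and diagonal entries `∑ k, ω i k`. -/
def omegaMat {n : ℕ} (ω : Fin n → Fin n → ℝ) : Matrix (Fin n) (Fin n) ℝ :=
  fun i j => if i = j then ∑ k, ω i k else -ω i j

/-- The `3n×3n` stress matrix `Ω_Y(ω,λ) = diag(Ω+Λ, Ω+Λ, Ω)` on a family of concentric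
cylinders, indexed by `Fin 3 × Fin n` (coordinate block × vertex). -/
def stressMatY {n : ℕ} (ω : Fin n → Fin n → ℝ) (lam : Fin n → ℝ) :
    Matrix (Fin 3 × Fin n) (Fin 3 × Fin n) ℝ :=
  fun r c => if r.1 = c.1 then
      omegaMat ω r.2 c.2 + (if r.2 = c.2 ∧ r.1 ≠ 2 then lam r.2 else 0)
    else 0

/-- `(ω,λ)` is an equilibrium stress for `(G,p)` on the family of concentric cylinders:
`∑_j ω_ij (p_i − p_j) + λ_i (x_i, y_i, 0) = 0` for all `i`. -/
def IsEquilStressY {n : ℕ} (p : Fin n → Fin 3 → ℝ)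
    (ω : Fin n → Fin n → ℝ) (lam : Fin n → ℝ) : Prop :=
  ∀ i, ∀ a : Fin 3,
    (∑ j, ω i j * (p i a - p j a)) + lam i * (if a = 2 then 0 else p i a) = 0

/-- `(ω,λ)` is a stress for the graph `G`: `ω` is symmetric and supported on the edges. -/
def IsStress {n : ℕ} (G : SimpleGraph (Fin n)) (ω : Fin n → Fin n → ℝ) : Prop :=
  (∀ i j, ω i j = ω j i) ∧ (∀ i j, ¬ G.Adj i j → ω i j = 0)

/-- The `6 × 3n` configuration matrix `C_Y(G,p)` for a framework on a family of
concentric cylinders, with rows `(x|0|0), (0|y|0), (0|0|z), (y|0|0), (0|x|0), (0|0|1)`. -/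
def configMatY {n : ℕ} (p : Fin n → Fin 3 → ℝ) : Matrix (Fin 6) (Fin 3 × Fin n) ℝ :=
  Matrix.of ![
    fun c => if c.1 = 0 then p c.2 0 else 0,
    fun c => if c.1 = 1 then p c.2 1 else 0,
    fun c => if c.1 = 2 then p c.2 2 else 0,
    fun c => if c.1 = 0 then p c.2 1 else 0,
    fun c => if c.1 = 1 then p c.2 0 else 0,
    fun c => if c.1 = 2 then 1 else 0]

/-- `G'` (on vertex set `{v_0} ∪ {v_1,…,v_n}`, the new vertex `v_0` being `0` and the old
vertex `v_i` being `i.succ`) is the 1-extension of `G` deleting the edge `i1 i2` and adding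
the new vertex `v_0` joined to `i1`, `i2` and `i3`. -/
def IsOneExtension {n : ℕ} (G : SimpleGraph (Fin n)) (G' : SimpleGraph (Fin (n + 1)))
    (i1 i2 i3 : Fin n) : Prop :=
  G.Adj i1 i2 ∧ i3 ≠ i1 ∧ i3 ≠ i2 ∧
  (∀ u v : Fin n, G'.Adj u.succ v.succ ↔
    (G.Adj u v ∧ ¬((u = i1 ∧ v = i2) ∨ (u = i2 ∧ v = i1)))) ∧
  (∀ u : Fin n, G'.Adj 0 u.succ ↔ (u = i1 ∨ u = i2 ∨ u = i3))

open Matrix in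
/-- The Gram matrix of `A` stacked on top of `D`. -/
def gramSum {m k N : Type*} [Fintype m] [Fintype k] (A : Matrix m N ℝ) (D : Matrix k N ℝ) :
    Matrix N N ℝ :=
  Aᵀ * A + Dᵀ * D

section Gram

open Matrix Module

variable {m N : Type*} [Fintype m] [Fintype N] [DecidableEq N] {k : ℕ}

lemma dotProduct_gramSum_mulVec {m k N : Type*} [Fintype m] [Fintype k] [Fintype N]
    (A : Matrix m N ℝ) (D : Matrix k N ℝ) (u v : N → ℝ) :
    u ⬝ᵥ (gramSum A D *ᵥ v) = (A *ᵥ u) ⬝ᵥ (A *ᵥ v) + (D *ᵥ u) ⬝ᵥ (D *ᵥ v) := by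
  simp [gramSum, add_mulVec, dotProduct_add, ← mulVec_mulVec, dotProduct_mulVec, vecMul_transpose]

lemma det_gramSum_ne_zero_iff {m k N : Type*} [Fintype m] [Fintype k] [Fintype N] [DecidableEq N]
    (A : Matrix m N ℝ) (D : Matrix k N ℝ) :
    (gramSum A D).det ≠ 0 ↔ ∀ v, A *ᵥ v = 0 → D *ᵥ v = 0 → v = 0 := by
  rw [Ne, ← exists_mulVec_eq_zero_iff]
  push Not
  constructor
  · intro h v hA hD
    by_contra hv
    apply h v hv
    simp [gramSum, add_mulVec, ← mulVec_mulVec, hA, hD]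
  · intro h v hv h0
    apply hv
    have h1 := dotProduct_gramSum_mulVec A D v v
    rw [h0, dotProduct_zero] at h1
    have hA : 0 ≤ (A *ᵥ v) ⬝ᵥ (A *ᵥ v) := Finset.sum_nonneg fun i _ => mul_self_nonneg _
    have hD : 0 ≤ (D *ᵥ v) ⬝ᵥ (D *ᵥ v) := Finset.sum_nonneg fun i _ => mul_self_nonneg _
    exact h v (dotProduct_self_eq_zero.1 (by linarith)) (dotProduct_self_eq_zero.1 (by linarith))

lemma finrank_ker_le_of_det_gramSum_ne_zero (A : Matrix m N ℝ) (D : Matrix (Fin k) N ℝ)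
    (h : (gramSum A D).det ≠ 0) : finrank ℝ (LinearMap.ker A.mulVecLin) ≤ k := by
  rw [det_gramSum_ne_zero_iff] at h
  have := LinearMap.finrank_le_finrank_of_injective
    (f := D.mulVecLin ∘ₗ (LinearMap.ker A.mulVecLin).subtype) (by
      rw [← LinearMap.ker_eq_bot, LinearMap.ker_eq_bot']
      rintro ⟨v, hv⟩ h0
      exact Subtype.ext (h v hv h0))
  simpa using this

lemma exists_det_gramSum_ne_zero (A : Matrix m N ℝ)
    (h : finrank ℝ (LinearMap.ker A.mulVecLin) ≤ k) :
    ∃ D : Matrix (Fin k) N ℝ, (gramSum A D).det ≠ 0 := by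
  obtain ⟨f, hf⟩ : ∃ f : LinearMap.ker A.mulVecLin →ₗ[ℝ] (Fin k → ℝ), Function.Injective f := by
    have : finrank ℝ (LinearMap.ker A.mulVecLin) ≤ finrank ℝ (Fin k → ℝ) := by simpa using h
    exact finrank_le_iff_exists_linearMap.1 this
  obtain ⟨g, hg⟩ := LinearMap.exists_extend f
  refine ⟨LinearMap.toMatrix' g, ?_⟩
  rw [det_gramSum_ne_zero_iff]
  intro v hA hD
  rw [LinearMap.toMatrix'_mulVec] at hD
  have h1 : f ⟨v, hA⟩ = 0 := by rw [← hg]; exact hD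
  have h2 := hf (h1.trans (map_zero f).symm)
  simpa using congrArg Subtype.val h2

/-- `det (gramSum A D)` times the orthogonal projection of `w` onto the left kernel of `A`,
written so that it is polynomial in all the data. -/
def leftKerProj (A : Matrix m N ℝ) (D : Matrix (Fin k) N ℝ) (w : m → ℝ) : m → ℝ :=
  (gramSum A D).det • w - A *ᵥ ((gramSum A D).adjugate *ᵥ (Aᵀ *ᵥ w))

lemma leftKerProj_vecMul (A : Matrix m N ℝ) (D : Matrix (Fin k) N ℝ) (w : m → ℝ)
    (hk : k ≤ finrank ℝ (LinearMap.ker A.mulVecLin)) (h : (gramSum A D).det ≠ 0) :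
    leftKerProj A D w ᵥ* A = 0 := by
  set v := (gramSum A D).adjugate *ᵥ (Aᵀ *ᵥ w) with hv
  have hNv : gramSum A D *ᵥ v = (gramSum A D).det • (Aᵀ *ᵥ w) := by
    rw [hv, mulVec_mulVec, mul_adjugate, smul_mulVec, one_mulVec]
  have hinj : Function.Injective (D.mulVecLin ∘ₗ (LinearMap.ker A.mulVecLin).subtype) := by
    rw [← LinearMap.ker_eq_bot, LinearMap.ker_eq_bot']
    rintro ⟨v, hv⟩ h0
    exact Subtype.ext ((det_gramSum_ne_zero_iff A D).1 h v hv h0)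
  have hdim : finrank ℝ (LinearMap.ker A.mulVecLin) = finrank ℝ (Fin k → ℝ) := by
    simpa using le_antisymm (finrank_ker_le_of_det_gramSum_ne_zero A D h) hk
  obtain ⟨⟨t, ht⟩, htv⟩ := (LinearMap.injective_iff_surjective_of_finrank_eq_finrank hdim).1 hinj
    (D *ᵥ v)
  have ht' : A *ᵥ t = 0 := ht
  have htv' : D *ᵥ t = D *ᵥ v := htv
  have h1 := dotProduct_gramSum_mulVec A D t v
  rw [hNv, ht', htv', zero_dotProduct, zero_add, dotProduct_smul, dotProduct_mulVec,
    vecMul_transpose, ht', zero_dotProduct, smul_zero] at h1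
  have hDv : D *ᵥ v = 0 := dotProduct_self_eq_zero.1 h1.symm
  have h2 : Aᵀ *ᵥ (A *ᵥ v) = (gramSum A D).det • (Aᵀ *ᵥ w) := by
    rw [← hNv, gramSum, add_mulVec, ← mulVec_mulVec, ← mulVec_mulVec, hDv, mulVec_zero, add_zero]
  rw [← mulVec_transpose, leftKerProj, mulVec_sub, ← hv, h2, mulVec_smul, sub_self]

lemma leftKerProj_of_vecMul_eq_zero (A : Matrix m N ℝ) (D : Matrix (Fin k) N ℝ) (w : m → ℝ)
    (hw : w ᵥ* A = 0) : leftKerProj A D w = (gramSum A D).det • w := by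
  rw [leftKerProj, mulVec_transpose, hw, mulVec_zero, mulVec_zero, sub_zero]

/-- Along a line on which the nullity of a matrix is minimal at the base point, the direction
maps the kernel into the range. -/
lemma dotProduct_mulVec_eq_zero_of_finrank_ker_le (A B : Matrix m N ℝ)
    (h : ∀ t : ℝ, finrank ℝ (LinearMap.ker A.mulVecLin) ≤
      finrank ℝ (LinearMap.ker (A + t • B).mulVecLin))
    {w : m → ℝ} {v : N → ℝ} (hw : w ᵥ* A = 0) (hv : A *ᵥ v = 0) : w ⬝ᵥ (B *ᵥ v) = 0 := by
  obtain ⟨D, hD⟩ := exists_det_gramSum_ne_zero A le_rfl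
  have hcA : Continuous fun t : ℝ => A + t • B := by fun_prop
  have hcN : Continuous fun t : ℝ => gramSum (A + t • B) D := by
    unfold gramSum; fun_prop
  have hcw : Continuous fun t : ℝ => leftKerProj (A + t • B) D w := by
    unfold leftKerProj
    exact (hcN.matrix_det.smul continuous_const).sub
      (hcA.matrix_mulVec (hcN.matrix_adjugate.matrix_mulVec
        (hcA.matrix_transpose.matrix_mulVec continuous_const)))
  have hcf : Continuous fun t : ℝ => leftKerProj (A + t • B) D w ⬝ᵥ (B *ᵥ v) :=
    hcw.dotProduct continuous_const
  have hne : ∀ᶠ t in nhds (0 : ℝ), (gramSum (A + t • B) D).det ≠ 0 :=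
    hcN.matrix_det.continuousAt.eventually_ne (by simpa using hD)
  have hz : ∀ᶠ t in nhdsWithin (0 : ℝ) {0}ᶜ,
      leftKerProj (A + t • B) D w ⬝ᵥ (B *ᵥ v) = 0 := by
    filter_upwards [nhdsWithin_le_nhds hne, self_mem_nhdsWithin] with t ht ht0
    have h1 := leftKerProj_vecMul (A + t • B) D w (h t) ht
    have h2 := dotProduct_mulVec (leftKerProj (A + t • B) D w) (A + t • B) v
    rw [h1, zero_dotProduct, add_mulVec, hv, zero_add, smul_mulVec, dotProduct_smul,
      smul_eq_mul] at h2
    exact (mul_eq_zero.1 h2).resolve_left ht0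
  have h0 : leftKerProj (A + (0 : ℝ) • B) D w ⬝ᵥ (B *ᵥ v) = 0 :=
    tendsto_nhds_unique (hcf.continuousAt.tendsto.mono_left nhdsWithin_le_nhds)
      (tendsto_const_nhds.congr' (hz.mono fun t ht => ht.symm))
  rw [zero_smul, add_zero, leftKerProj_of_vecMul_eq_zero A D w hw, smul_dotProduct,
    smul_eq_mul] at h0
  exact (mul_eq_zero.1 h0).resolve_left hD

end Gram

section RatPoly

open Matrix Module

/-- A real function of real variables that is given by a polynomial with rational coefficients. -/
def RatPoly {ι : Type*} (f : (ι → ℝ) → ℝ) : Prop :=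
  ∃ F : MvPolynomial ι ℚ, ∀ x, f x = MvPolynomial.aeval x F

namespace RatPoly

variable {ι κ : Type*} {f g : (ι → ℝ) → ℝ}

lemma coord (i : ι) : RatPoly fun x : ι → ℝ => x i := ⟨MvPolynomial.X i, by simp⟩

lemma const (c : ℚ) : RatPoly fun _ : ι → ℝ => (c : ℝ) := ⟨MvPolynomial.C c, by simp⟩

lemma zero : RatPoly fun _ : ι → ℝ => (0 : ℝ) := ⟨0, by simp⟩

lemma one : RatPoly fun _ : ι → ℝ => (1 : ℝ) := ⟨1, by simp⟩

lemma add (hf : RatPoly f) (hg : RatPoly g) : RatPoly fun x => f x + g x := by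
  obtain ⟨F, hF⟩ := hf
  obtain ⟨G, hG⟩ := hg
  exact ⟨F + G, by simp [hF, hG]⟩

lemma mul (hf : RatPoly f) (hg : RatPoly g) : RatPoly fun x => f x * g x := by
  obtain ⟨F, hF⟩ := hf
  obtain ⟨G, hG⟩ := hg
  exact ⟨F * G, by simp [hF, hG]⟩

lemma neg (hf : RatPoly f) : RatPoly fun x => - f x := by
  obtain ⟨F, hF⟩ := hf
  exact ⟨-F, by simp [hF]⟩

lemma sub (hf : RatPoly f) (hg : RatPoly g) : RatPoly fun x => f x - g x := by
  simpa only [sub_eq_add_neg] using hf.add hg.neg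

lemma ite {P : Prop} [Decidable P] (hf : RatPoly f) (hg : RatPoly g) :
    RatPoly fun x => if P then f x else g x := by
  split_ifs
  · exact hf
  · exact hg

lemma sum {α : Type*} (s : Finset α) {f : α → (ι → ℝ) → ℝ} (hf : ∀ a, RatPoly (f a)) :
    RatPoly fun x => ∑ a ∈ s, f a x := by
  choose F hF using hf
  exact ⟨∑ a ∈ s, F a, by simp [hF]⟩

lemma prod {α : Type*} (s : Finset α) {f : α → (ι → ℝ) → ℝ} (hf : ∀ a, RatPoly (f a)) :
    RatPoly fun x => ∏ a ∈ s, f a x := by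
  choose F hF using hf
  exact ⟨∏ a ∈ s, F a, by simp [hF]⟩

lemma comp (hf : RatPoly f) {h : (κ → ℝ) → ι → ℝ} (hh : ∀ i, RatPoly fun y => h y i) :
    RatPoly fun y => f (h y) := by
  obtain ⟨F, hF⟩ := hf
  choose H hH using hh
  refine ⟨MvPolynomial.aeval H F, fun y => ?_⟩
  change f (h y) = _
  rw [hF, MvPolynomial.comp_aeval_apply]
  congr 2
  exact funext fun i => hH i y

lemma det {N : Type*} [Fintype N] [DecidableEq N] {M : (ι → ℝ) → Matrix N N ℝ}
    (hM : ∀ i j, RatPoly fun x => M x i j) : RatPoly fun x => (M x).det := by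
  simp only [det_apply']
  refine sum _ fun σ => mul ?_ (prod _ fun i => hM _ _)
  simpa using const (ι := ι) ((Equiv.Perm.sign σ : ℤ) : ℚ)

lemma adjugate {N : Type*} [Fintype N] [DecidableEq N] {M : (ι → ℝ) → Matrix N N ℝ}
    (hM : ∀ i j, RatPoly fun x => M x i j) (i j : N) : RatPoly fun x => (M x).adjugate i j := by
  simp only [adjugate_apply]
  refine det fun a b => ?_
  simp only [updateRow_apply, Pi.single_apply]
  exact ite (ite one zero) (hM a b)

lemma mulVec {m N : Type*} [Fintype N] {M : (ι → ℝ) → Matrix m N ℝ} {v : (ι → ℝ) → N → ℝ}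
    (hM : ∀ i j, RatPoly fun x => M x i j) (hv : ∀ j, RatPoly fun x => v x j) (i : m) :
    RatPoly fun x => (M x *ᵥ v x) i :=
  sum _ fun j => (hM i j).mul (hv j)

lemma gramSum {m k N : Type*} [Fintype m] [Fintype k] {A : (ι → ℝ) → Matrix m N ℝ}
    {D : (ι → ℝ) → Matrix k N ℝ} (hA : ∀ i j, RatPoly fun x => A x i j)
    (hD : ∀ i j, RatPoly fun x => D x i j) (i j : N) :
    RatPoly fun x => gramSum (A x) (D x) i j :=
  (sum _ fun a => (hA a i).mul (hA a j)).add (sum _ fun a => (hD a i).mul (hD a j))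

lemma leftKerProj {m N : Type*} [Fintype m] [Fintype N] [DecidableEq N] {k : ℕ}
    {A : (ι → ℝ) → Matrix m N ℝ} {D : (ι → ℝ) → Matrix (Fin k) N ℝ} {w : (ι → ℝ) → m → ℝ}
    (hA : ∀ i j, RatPoly fun x => A x i j) (hD : ∀ i j, RatPoly fun x => D x i j)
    (hw : ∀ i, RatPoly fun x => w x i) (i : m) :
    RatPoly fun x => leftKerProj (A x) (D x) (w x) i :=
  ((det (gramSum hA hD)).mul (hw i)).sub
    (mulVec hA (mulVec (adjugate (gramSum hA hD)) (mulVec (fun a b => hA b a) hw)) i)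

lemma continuous (hf : RatPoly f) :
    Continuous f := by
  obtain ⟨F, hF⟩ := hf
  have h : f = fun x => MvPolynomial.eval x (MvPolynomial.map (algebraMap ℚ ℝ) F) := by
    funext x
    rw [hF, MvPolynomial.eval_map, MvPolynomial.aeval_def]
  rw [h]
  exact MvPolynomial.continuous_eval _

lemma exists_ne_zero_of_algebraicIndependent {f : (ι ⊕ κ → ℝ) → ℝ} (hf : RatPoly f)
    {x : ι ⊕ κ → ℝ} (hx : f x ≠ 0) {q : ι → ℝ} (hq : AlgebraicIndependent ℚ q) :
    ∃ c : κ → ℝ, f (Sum.elim q c) ≠ 0 := by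
  obtain ⟨F, hF⟩ := hf
  have hF0 : F ≠ 0 := by
    rintro rfl
    exact hx (by simp [hF])
  obtain ⟨y, hy⟩ : ∃ y : ι ⊕ κ → ℚ, MvPolynomial.aeval y F ≠ 0 := by
    by_contra! h
    exact hF0 (MvPolynomial.funext fun y => by simpa using h y)
  set F₁ : MvPolynomial ι ℚ := MvPolynomial.aeval
    (Sum.elim MvPolynomial.X fun k => MvPolynomial.C (y (Sum.inr k))) F with hF₁
  have key {B : Type} [CommRing B] [Algebra ℚ B] (z : ι → B) : MvPolynomial.aeval z F₁ =
      MvPolynomial.aeval (Sum.elim z fun k => algebraMap ℚ B (y (Sum.inr k))) F := by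
    rw [hF₁, MvPolynomial.comp_aeval_apply]
    congr 2
    funext i
    cases i <;> simp
  refine ⟨fun k => y (Sum.inr k), fun h0 => hy ?_⟩
  have h1 : MvPolynomial.aeval q F₁ = 0 := by
    rw [key, ← h0, hF]
    rfl
  have h2 : F₁ = 0 := algebraicIndependent_iff.1 hq _ h1
  have h3 := key fun i => y (Sum.inl i)
  rw [h2, map_zero] at h3
  rw [h3]
  congr 2
  funext i
  cases i <;> simp

lemma ne_zero_of_algebraicIndependent (hf : RatPoly f) {x : ι → ℝ} (hx : f x ≠ 0) {q : ι → ℝ}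
    (hq : AlgebraicIndependent ℚ q) : f q ≠ 0 := by
  obtain ⟨F, hF⟩ := hf
  intro h
  rw [hF] at h
  apply hx
  rw [hF, algebraicIndependent_iff.1 hq F h, map_zero]

end RatPoly

section Generic

variable {ι m N : Type*} [Fintype m] [Fintype N]
  {A : (ι → ℝ) → Matrix m N ℝ} {q : ι → ℝ}

lemma finrank_ker_le_of_algebraicIndependent (hA : ∀ i j, RatPoly fun x => A x i j)
    (hq : AlgebraicIndependent ℚ q) (p : ι → ℝ) :
    finrank ℝ (LinearMap.ker (A q).mulVecLin) ≤ finrank ℝ (LinearMap.ker (A p).mulVecLin) := by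
  classical
  set k := finrank ℝ (LinearMap.ker (A p).mulVecLin)
  obtain ⟨D, hD⟩ := exists_det_gramSum_ne_zero (A p) (k := k) le_rfl
  have hf : RatPoly fun x : ι ⊕ (Fin k × N) → ℝ =>
      (gramSum (A fun i => x (Sum.inl i)) (Matrix.of fun i j => x (Sum.inr (i, j)))).det :=
    RatPoly.det (RatPoly.gramSum (fun i j => (hA i j).comp fun _ => RatPoly.coord _)
      fun i j => RatPoly.coord _)
  obtain ⟨c, hc⟩ := hf.exists_ne_zero_of_algebraicIndependent
    (x := Sum.elim p fun i => D i.1 i.2) hD hq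
  exact finrank_ker_le_of_det_gramSum_ne_zero _ _ hc

lemma exists_left_kernel_of_algebraicIndependent {m' N' : Type*} [Fintype m'] [Fintype N']
    (hA : ∀ i j, RatPoly fun x => A x i j)
    {S : (m → ℝ) → Matrix m' N' ℝ} (hS : ∀ i j, RatPoly fun w => S w i j)
    (hq : AlgebraicIndependent ℚ q) {p : ι → ℝ}
    (hp : finrank ℝ (LinearMap.ker (A p).mulVecLin) ≤ finrank ℝ (LinearMap.ker (A q).mulVecLin))
    {w : m → ℝ} (hw : w ᵥ* A p = 0) :
    ∃ w' : m → ℝ, w' ᵥ* A q = 0 ∧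
      finrank ℝ (LinearMap.ker (S w').mulVecLin) ≤ finrank ℝ (LinearMap.ker (S w).mulVecLin) := by
  classical
  set k := finrank ℝ (LinearMap.ker (A q).mulVecLin) with hk
  set l := finrank ℝ (LinearMap.ker (S w).mulVecLin)
  obtain ⟨D, hD⟩ := exists_det_gramSum_ne_zero (A p) (k := k) hp
  obtain ⟨D', hD'⟩ := exists_det_gramSum_ne_zero (S w) (k := l) le_rfl
  let fA : (ι ⊕ (m ⊕ (Fin k × N) ⊕ (Fin l × N')) → ℝ) → Matrix m N ℝ :=
    fun x => A fun i => x (Sum.inl i)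
  let fD : (ι ⊕ (m ⊕ (Fin k × N) ⊕ (Fin l × N')) → ℝ) → Matrix (Fin k) N ℝ :=
    fun x => Matrix.of fun i j => x (Sum.inr (Sum.inr (Sum.inl (i, j))))
  let fw : (ι ⊕ (m ⊕ (Fin k × N) ⊕ (Fin l × N')) → ℝ) → m → ℝ :=
    fun x i => x (Sum.inr (Sum.inl i))
  let fD' : (ι ⊕ (m ⊕ (Fin k × N) ⊕ (Fin l × N')) → ℝ) → Matrix (Fin l) N' ℝ :=
    fun x => Matrix.of fun i j => x (Sum.inr (Sum.inr (Sum.inr (i, j))))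
  have hfA : ∀ i j, RatPoly fun x => fA x i j :=
    fun i j => (hA i j).comp fun _ => RatPoly.coord _
  have hfD : ∀ i j, RatPoly fun x => fD x i j := fun i j => RatPoly.coord _
  have hf : RatPoly fun x => (gramSum (fA x) (fD x)).det *
      (gramSum (S (leftKerProj (fA x) (fD x) (fw x))) (fD' x)).det :=
    (RatPoly.det (RatPoly.gramSum hfA hfD)).mul (RatPoly.det (RatPoly.gramSum
      (fun i j => (hS i j).comp (RatPoly.leftKerProj hfA hfD fun i => RatPoly.coord _))
      fun i j => RatPoly.coord _))
  have hproj : leftKerProj (A p) D (((gramSum (A p) D).det)⁻¹ • w) = w := by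
    rw [leftKerProj_of_vecMul_eq_zero _ _ _ (by rw [smul_vecMul, hw, smul_zero]),
      smul_inv_smul₀ hD]
  obtain ⟨c, hc⟩ := hf.exists_ne_zero_of_algebraicIndependent
    (x := Sum.elim p (Sum.elim (((gramSum (A p) D).det)⁻¹ • w)
      (Sum.elim (fun i => D i.1 i.2) fun i => D' i.1 i.2)))
    (mul_ne_zero hD (by
      change (gramSum (S (leftKerProj (A p) D (((gramSum (A p) D).det)⁻¹ • w))) D').det ≠ 0
      rwa [hproj])) hq
  exact ⟨_, leftKerProj_vecMul _ _ _ hk.le (left_ne_zero_of_mul hc),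
    finrank_ker_le_of_det_gramSum_ne_zero _ _ (right_ne_zero_of_mul hc)⟩

end Generic

end RatPoly

section Framework

open Matrix Module

variable {n : ℕ}

/-- The rigidity matrix on concentric cylinders, with edge rows indexed by ordered pairs. -/
noncomputable def rigMat (G : SimpleGraph (Fin n)) (p : Fin 3 × Fin n → ℝ) :
    Matrix ((Fin n × Fin n) ⊕ Fin n) (Fin 3 × Fin n) ℝ :=
  open Classical in
  fun r c => match r with
    | Sum.inl e => if G.Adj e.1 e.2 then
        (p (c.1, e.1) - p (c.1, e.2)) * ((if c.2 = e.1 then 1 else 0) - if c.2 = e.2 then 1 else 0)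
        else 0
    | Sum.inr i => if c.2 = i then if c.1 = 2 then 0 else p (c.1, i) else 0

/-- Infinitesimal motions on concentric cylinders. -/
def IsInfMotion (G : SimpleGraph (Fin n)) (p u : Fin 3 × Fin n → ℝ) : Prop :=
  (∀ i j, G.Adj i j → ∑ a, (p (a, i) - p (a, j)) * (u (a, i) - u (a, j)) = 0) ∧
    ∀ i, p (0, i) * u (0, i) + p (1, i) * u (1, i) = 0

lemma rigMat_mulVec_inl (G : SimpleGraph (Fin n)) (p u : Fin 3 × Fin n → ℝ) {i j : Fin n}
    (h : G.Adj i j) : (rigMat G p *ᵥ u) (Sum.inl (i, j)) =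
      ∑ a, (p (a, i) - p (a, j)) * (u (a, i) - u (a, j)) := by
  simp [mulVec, dotProduct, rigMat, Fintype.sum_prod_type, h, mul_sub, sub_mul,
    Finset.sum_sub_distrib]

lemma rigMat_mulVec_inl_of_not_adj (G : SimpleGraph (Fin n)) (p u : Fin 3 × Fin n → ℝ)
    {i j : Fin n} (h : ¬ G.Adj i j) : (rigMat G p *ᵥ u) (Sum.inl (i, j)) = 0 := by
  simp [mulVec, dotProduct, rigMat, h]

lemma rigMat_mulVec_inr (G : SimpleGraph (Fin n)) (p u : Fin 3 × Fin n → ℝ) (i : Fin n) :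
    (rigMat G p *ᵥ u) (Sum.inr i) = p (0, i) * u (0, i) + p (1, i) * u (1, i) := by
  simp [mulVec, dotProduct, rigMat, Fintype.sum_prod_type, Fin.sum_univ_three]

lemma rigMat_mulVec_eq_zero_iff (G : SimpleGraph (Fin n)) (p u : Fin 3 × Fin n → ℝ) :
    rigMat G p *ᵥ u = 0 ↔ IsInfMotion G p u := by
  constructor
  · intro h
    exact ⟨fun i j hij => by rw [← rigMat_mulVec_inl G p u hij, h]; rfl,
      fun i => by rw [← rigMat_mulVec_inr G p u i, h]; rfl⟩
  · rintro ⟨h1, h2⟩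
    funext r
    rcases r with ⟨i, j⟩ | i
    · by_cases h : G.Adj i j
      · rw [rigMat_mulVec_inl G p u h, h1 i j h]; rfl
      · rw [rigMat_mulVec_inl_of_not_adj G p u h]; rfl
    · rw [rigMat_mulVec_inr, h2]; rfl

lemma rigidityMatY_mulVec_eq_zero_iff (G : SimpleGraph (Fin n)) [DecidableRel G.Adj]
    (p : Fin n → Fin 3 → ℝ) (u : Fin 3 × Fin n → ℝ) :
    rigidityMatY G p *ᵥ u = 0 ↔ IsInfMotion G (fun c => p c.2 c.1) u := by
  have hinl : ∀ i j, G.Adj i j → (rigidityMatY G p *ᵥ u) (Sum.inl s(i, j)) =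
      ∑ a, (p i a - p j a) * (u (a, i) - u (a, j)) := by
    intro i j hij
    have hne := hij.ne
    simp only [mulVec, dotProduct, rigidityMatY, Fintype.sum_prod_type]
    refine Finset.sum_congr rfl fun a _ => ?_
    have hother : ∀ (k : Fin n) (h : k ∈ s(i, j)),
        Sym2.Mem.other' h = if k = i then j else i := by
      intro k h
      have h1 := Sym2.other_spec' h
      rcases Sym2.mem_iff.1 h with rfl | rfl
      · rw [if_pos rfl]
        exact Sym2.congr_right.1 h1
      · rw [if_neg hne.symm]
        exact Sym2.congr_right.1 (h1.trans Sym2.eq_swap)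
    rw [← Finset.sum_subset (Finset.subset_univ {i, j})]
    · rw [Finset.sum_pair hne]
      simp only [SimpleGraph.mem_edgeSet, hij, if_true, Sym2.mem_iff, true_or, or_true, dite_true,
        hother, hne.symm, if_false]
      ring
    · intro k _ hk
      have : ¬ k ∈ s(i, j) := by simpa using hk
      simp [this]
  have hinl' : ∀ e, e ∉ G.edgeSet → (rigidityMatY G p *ᵥ u) (Sum.inl e) = 0 := by
    intro e he
    simp [mulVec, dotProduct, rigidityMatY, he]
  have hinr : ∀ i, (rigidityMatY G p *ᵥ u) (Sum.inr i) =
      p i 0 * u (0, i) + p i 1 * u (1, i) := by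
    intro i
    simp [mulVec, dotProduct, rigidityMatY, Fintype.sum_prod_type, Fin.sum_univ_three]
  constructor
  · intro h
    exact ⟨fun i j hij => by rw [← hinl i j hij, h]; rfl, fun i => by rw [← hinr i, h]; rfl⟩
  · rintro ⟨h1, h2⟩
    funext r
    rcases r with e | i
    · induction e using Sym2.ind with
      | _ i j =>
        by_cases h : G.Adj i j
        · rw [hinl i j h, h1 i j h]; rfl
        · rw [hinl' _ h]; rfl
    · rw [hinr, h2]; rfl

lemma rank_add_finrank_ker {m N : Type*} [Fintype N] (M : Matrix m N ℝ) :
    M.rank + finrank ℝ (LinearMap.ker M.mulVecLin) = Fintype.card N := by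
  rw [Matrix.rank, LinearMap.finrank_range_add_finrank_ker, finrank_pi]

lemma rank_rigidityMatY_add_finrank_ker_rigMat (G : SimpleGraph (Fin n)) [DecidableRel G.Adj]
    (p : Fin n → Fin 3 → ℝ) : (rigidityMatY G p).rank +
      finrank ℝ (LinearMap.ker (rigMat G fun c => p c.2 c.1).mulVecLin) = 3 * n := by
  have h : LinearMap.ker (rigMat G fun c => p c.2 c.1).mulVecLin =
      LinearMap.ker (rigidityMatY G p).mulVecLin := by
    ext u
    simp only [LinearMap.mem_ker, mulVecLin_apply, rigMat_mulVec_eq_zero_iff,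
      rigidityMatY_mulVec_eq_zero_iff]
  rw [h, rank_add_finrank_ker]
  simp

lemma ratPoly_rigMat (G : SimpleGraph (Fin n)) (r c) : RatPoly fun p => rigMat G p r c := by
  classical
  rcases r with e | i
  · exact .ite (((RatPoly.coord _).sub (.coord _)).mul ((RatPoly.ite .one .zero).sub
      (.ite .one .zero))) .zero
  · exact .ite (.ite .zero (.coord _)) .zero

lemma rigMat_add_smul (G : SimpleGraph (Fin n)) (p u : Fin 3 × Fin n → ℝ) (t : ℝ) :
    rigMat G (p + t • u) = rigMat G p + t • rigMat G u := by
  ext r c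
  rcases r with e | i
  · by_cases h : G.Adj e.1 e.2
    · simp only [rigMat, h, if_true, Pi.add_apply, Pi.smul_apply, Matrix.add_apply,
        Matrix.smul_apply, smul_eq_mul]
      ring
    · simp [rigMat, h]
  · by_cases h : c.2 = i <;> by_cases h' : c.1 = 2 <;> simp [rigMat, h, h']

lemma rigMat_mulVec_comm (G : SimpleGraph (Fin n)) (p u : Fin 3 × Fin n → ℝ) :
    rigMat G p *ᵥ u = rigMat G u *ᵥ p := by
  funext r
  rcases r with ⟨i, j⟩ | i
  · by_cases h : G.Adj i j
    · simp only [rigMat_mulVec_inl _ _ _ h, mul_comm]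
    · simp only [rigMat_mulVec_inl_of_not_adj _ _ _ h]
  · simp only [rigMat_mulVec_inr, mul_comm]

/-- The edge part of the stress given by a vector of row coefficients of `rigMat G`. -/
noncomputable def edgeStress (G : SimpleGraph (Fin n)) (w : (Fin n × Fin n) ⊕ Fin n → ℝ) :
    Fin n → Fin n → ℝ :=
  open Classical in
  fun i j => if G.Adj i j then w (Sum.inl (i, j)) + w (Sum.inl (j, i)) else 0

lemma isStress_edgeStress (G : SimpleGraph (Fin n)) (w : (Fin n × Fin n) ⊕ Fin n → ℝ) :
    IsStress G (edgeStress G w) := by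
  refine ⟨fun i j => ?_, fun i j h => by simp [edgeStress, h]⟩
  by_cases h : G.Adj i j
  · simp [edgeStress, h, h.symm, add_comm]
  · simp [edgeStress, h, G.adj_comm j i]

lemma vecMul_rigMat (G : SimpleGraph (Fin n)) (p : Fin 3 × Fin n → ℝ)
    (w : (Fin n × Fin n) ⊕ Fin n → ℝ) (a : Fin 3) (i : Fin n) :
    (w ᵥ* rigMat G p) (a, i) = (∑ j, edgeStress G w i j * (p (a, i) - p (a, j))) +
      w (Sum.inr i) * (if a = 2 then 0 else p (a, i)) := by
  classical
  simp only [vecMul, dotProduct, Fintype.sum_sum_type, Fintype.sum_prod_type, rigMat]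
  congr 1
  · have h1 : ∀ k l : Fin n, w (Sum.inl (k, l)) * (if G.Adj k l then (p (a, k) - p (a, l)) *
        ((if i = k then 1 else 0) - if i = l then 1 else 0) else 0) =
        (if i = k then w (Sum.inl (k, l)) * if G.Adj k l then p (a, k) - p (a, l) else 0 else 0) -
        (if i = l then w (Sum.inl (k, l)) * if G.Adj k l then p (a, k) - p (a, l) else 0
          else 0) := by
      intro k l
      split_ifs <;> ring
    simp only [h1, Finset.sum_sub_distrib]
    rw [Finset.sum_comm]
    simp only [Finset.sum_ite_eq, Finset.mem_univ, if_true]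
    rw [← Finset.sum_sub_distrib]
    refine Finset.sum_congr rfl fun j _ => ?_
    simp only [edgeStress, G.adj_comm j i]
    split_ifs <;> ring
  · simp

lemma vecMul_rigMat_eq_zero_iff (G : SimpleGraph (Fin n)) (p : Fin 3 × Fin n → ℝ)
    (w : (Fin n × Fin n) ⊕ Fin n → ℝ) : w ᵥ* rigMat G p = 0 ↔
      IsEquilStressY (fun i a => p (a, i)) (edgeStress G w) (fun i => w (Sum.inr i)) := by
  constructor
  · intro h i a
    rw [← vecMul_rigMat, h]
    rfl
  · intro h
    funext ⟨a, i⟩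
    rw [vecMul_rigMat]
    exact h i a

lemma exists_edgeStress_eq {G : SimpleGraph (Fin n)} {ω : Fin n → Fin n → ℝ} (hω : IsStress G ω)
    (lam : Fin n → ℝ) :
    ∃ w, edgeStress G w = ω ∧ (fun i => w (Sum.inr i)) = lam := by
  refine ⟨Sum.elim (fun e => ω e.1 e.2 / 2) lam, ?_, rfl⟩
  funext i j
  by_cases h : G.Adj i j
  · simp only [edgeStress, h, if_true, Sum.elim_inl]
    rw [hω.1 j i]
    ring
  · simp [edgeStress, h, hω.2 i j h]

lemma ratPoly_stressMatY (G : SimpleGraph (Fin n)) (r c) : RatPoly fun w =>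
    stressMatY (edgeStress G w) (fun i => w (Sum.inr i)) r c := by
  classical
  have h : ∀ i j, RatPoly fun w => edgeStress G w i j := fun i j =>
    .ite ((RatPoly.coord _).add (.coord _)) .zero
  exact .ite ((RatPoly.ite (.sum _ fun _ => h _ _) (h _ _).neg).add (.ite (.coord _) .zero)) .zero

lemma stressMatY_mulVec {ω : Fin n → Fin n → ℝ} (hω : ∀ i, ω i i = 0) (lam : Fin n → ℝ)
    (u : Fin 3 × Fin n → ℝ) (a : Fin 3) (i : Fin n) :
    (stressMatY ω lam *ᵥ u) (a, i) =
      (∑ j, ω i j * (u (a, i) - u (a, j))) + lam i * (if a = 2 then 0 else u (a, i)) := by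
  simp only [mulVec, dotProduct, stressMatY, Fintype.sum_prod_type, omegaMat]
  rw [Finset.sum_eq_single a (by intro b _ hb; simp [hb.symm]) (by simp)]
  simp only [if_true, add_mul, Finset.sum_add_distrib]
  congr 1
  · have h1 : ∀ j, (if i = j then ∑ k, ω i k else -ω i j) * u (a, j) =
        (if i = j then (∑ k, ω i k) * u (a, j) else 0) - ω i j * u (a, j) := by
      intro j
      split_ifs with h
      · subst h
        simp [hω]
      · ring
    simp only [h1, Finset.sum_sub_distrib, Finset.sum_ite_eq, Finset.mem_univ, if_true, mul_sub,
      Finset.sum_mul]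
  · by_cases ha : a = 2 <;> simp [ha]

lemma stressMatY_mulVec_edgeStress (G : SimpleGraph (Fin n)) (p : Fin 3 × Fin n → ℝ)
    (w : (Fin n × Fin n) ⊕ Fin n → ℝ) :
    stressMatY (edgeStress G w) (fun i => w (Sum.inr i)) *ᵥ p = w ᵥ* rigMat G p := by
  funext ⟨a, i⟩
  rw [vecMul_rigMat, stressMatY_mulVec fun i => (isStress_edgeStress G w).2 i i (G.irrefl)]


section GenericPosition

variable {p : Fin 3 × Fin n → ℝ}

lemma cross_ne_zero_of_algebraicIndependent (hp : AlgebraicIndependent ℚ p) {i j : Fin n}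
    (hij : i ≠ j) : p (0, i) * p (1, j) - p (0, j) * p (1, i) ≠ 0 := by
  have hf : RatPoly fun x : Fin 3 × Fin n → ℝ => x (0, i) * x (1, j) - x (0, j) * x (1, i) :=
    ((RatPoly.coord _).mul (.coord _)).sub ((RatPoly.coord _).mul (.coord _))
  exact hf.ne_zero_of_algebraicIndependent
    (x := fun c => if c = (0, i) ∨ c = (1, j) then 1 else 0) (by simp [hij, hij.symm]) hp

lemma ne_of_algebraicIndependent (hp : AlgebraicIndependent ℚ p) {c d : Fin 3 × Fin n}
    (h : c ≠ d) : p c ≠ p d := hp.injective.ne h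

lemma attach_det_ne_zero_of_algebraicIndependent (hp : AlgebraicIndependent ℚ p)
    {i j k : Fin n} (hij : i ≠ j) (hki : k ≠ i) (hkj : k ≠ j) :
    (p (0, i) + p (0, j)) * ((p (1, i) - p (1, j)) * (p (2, i) + p (2, j) - 2 * p (2, k)) -
        (p (2, i) - p (2, j)) * (p (1, i) + p (1, j) - 2 * p (1, k))) -
      (p (1, i) + p (1, j)) * ((p (0, i) - p (0, j)) * (p (2, i) + p (2, j) - 2 * p (2, k)) -
        (p (2, i) - p (2, j)) * (p (0, i) + p (0, j) - 2 * p (0, k))) ≠ 0 := by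
  have hadd : ∀ c d, RatPoly fun x : Fin 3 × Fin n → ℝ => x c + x d :=
    fun c d => (RatPoly.coord _).add (.coord _)
  have hsub : ∀ c d, RatPoly fun x : Fin 3 × Fin n → ℝ => x c - x d :=
    fun c d => (RatPoly.coord _).sub (.coord _)
  have htwo : ∀ c, RatPoly fun x : Fin 3 × Fin n → ℝ => 2 * x c :=
    fun c => RatPoly.mul (by simpa using RatPoly.const 2) (.coord _)
  have h3 : ∀ a, RatPoly fun x : Fin 3 × Fin n → ℝ => x (a, i) + x (a, j) - 2 * x (a, k) :=
    fun a => (hadd _ _).sub (htwo _)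
  have hf := ((hadd (0, i) (0, j)).mul (((hsub (1, i) (1, j)).mul (h3 2)).sub
    ((hsub (2, i) (2, j)).mul (h3 1)))).sub ((hadd (1, i) (1, j)).mul
    (((hsub (0, i) (0, j)).mul (h3 2)).sub ((hsub (2, i) (2, j)).mul (h3 0))))
  refine hf.ne_zero_of_algebraicIndependent (x := fun c => if c = (0, i) ∨ c = (1, i) ∨ c = (0, j)
    ∨ c = (2, k) then 1 else if c = (1, j) then -1 else 0) ?_ hp
  simp [hij, hij.symm, hki, hki.symm, hkj, hkj.symm]

end GenericPosition

lemma finrank_le_finrank_of_injOn {V V' : Type*} [AddCommGroup V] [Module ℝ V] [AddCommGroup V']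
    [Module ℝ V'] [FiniteDimensional ℝ V'] {K : Submodule ℝ V} {K' : Submodule ℝ V'}
    (f : V →ₗ[ℝ] V') (h : ∀ v ∈ K, f v ∈ K') (hinj : ∀ v ∈ K, f v = 0 → v = 0) :
    finrank ℝ K ≤ finrank ℝ K' := by
  refine LinearMap.finrank_le_finrank_of_injective (f := f.restrict h) ?_
  rw [← LinearMap.ker_eq_bot, LinearMap.ker_eq_bot']
  rintro ⟨v, hv⟩ h0
  exact Subtype.ext (hinj v hv (congrArg Subtype.val h0))

/-- The infinitesimal rigid motion of `ℝ³` preserving the `z`-axis, with angular velocity `c 0`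
and translation speed `c 1`. -/
def screwMotion (p : Fin 3 × Fin n → ℝ) : (Fin 2 → ℝ) →ₗ[ℝ] (Fin 3 × Fin n → ℝ) where
  toFun c d := ![-(c 0 * p (1, d.2)), c 0 * p (0, d.2), c 1] d.1
  map_add' c c' := by
    funext ⟨a, i⟩
    fin_cases a <;> simp <;> ring
  map_smul' t c := by
    funext ⟨a, i⟩
    fin_cases a <;> simp <;> ring

lemma two_le_finrank_ker_rigMat (G : SimpleGraph (Fin n)) {p : Fin 3 × Fin n → ℝ} {i : Fin n}
    (hi : p (0, i) ≠ 0) : 2 ≤ finrank ℝ (LinearMap.ker (rigMat G p).mulVecLin) := by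
  have h := finrank_le_finrank_of_injOn (K := (⊤ : Submodule ℝ (Fin 2 → ℝ)))
    (K' := LinearMap.ker (rigMat G p).mulVecLin) (screwMotion p) (fun c _ => by
      rw [LinearMap.mem_ker, mulVecLin_apply, rigMat_mulVec_eq_zero_iff]
      refine ⟨fun j k _ => ?_, fun j => ?_⟩
      · simp [screwMotion, Fin.sum_univ_three]
        ring
      · simp [screwMotion]
        ring) (fun c _ hc => by
      have h1 := congrFun hc (1, i)
      have h2 := congrFun hc (2, i)
      simp [screwMotion, hi] at h1 h2
      funext a
      fin_cases a
      · exact h1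
      · exact h2)
  simpa using h

section Config

variable {p : Fin n → Fin 3 → ℝ} {ω : Fin n → Fin n → ℝ} {lam : Fin n → ℝ}

lemma vecMul_configMatY (p : Fin n → Fin 3 → ℝ) (c : Fin 6 → ℝ) (i : Fin n) :
    (c ᵥ* configMatY p) (0, i) = c 0 * p i 0 + c 3 * p i 1 ∧
    (c ᵥ* configMatY p) (1, i) = c 1 * p i 1 + c 4 * p i 0 ∧
    (c ᵥ* configMatY p) (2, i) = c 2 * p i 2 + c 5 := by
  simp [vecMul, dotProduct, configMatY, Fin.sum_univ_six]

lemma stressMatY_mulVec_vecMul_configMatY (hω : ∀ i, ω i i = 0) (h : IsEquilStressY p ω lam)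
    (c : Fin 6 → ℝ) : stressMatY ω lam *ᵥ (c ᵥ* configMatY p) = 0 := by
  have hlin : ∀ (i : Fin n) (s t : ℝ) (f g : Fin n → ℝ),
      ∑ j, ω i j * ((s * f i + t * g i) - (s * f j + t * g j)) =
        s * ∑ j, ω i j * (f i - f j) + t * ∑ j, ω i j * (g i - g j) := by
    intro i s t f g
    simp only [Finset.mul_sum, ← Finset.sum_add_distrib]
    exact Finset.sum_congr rfl fun j _ => by ring
  funext ⟨a, i⟩
  have h0 := h i 0
  have h1 := h i 1
  have h2 := h i 2
  simp at h0 h1 h2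
  rw [stressMatY_mulVec hω]
  fin_cases a
  · simp only [Fin.zero_eta, (vecMul_configMatY p c _).1]
    rw [hlin i (c 0) (c 3) (fun i => p i 0) (fun i => p i 1)]
    simp
    linear_combination c 0 * h0 + c 3 * h1
  · simp only [Fin.mk_one, (vecMul_configMatY p c _).2.1]
    rw [hlin i (c 1) (c 4) (fun i => p i 1) (fun i => p i 0)]
    simp
    linear_combination c 1 * h1 + c 4 * h0
  · simp only [Fin.reduceFinMk, (vecMul_configMatY p c _).2.2]
    have h3 := hlin i (c 2) (c 5) (fun i => p i 2) (fun _ => 1)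
    simp at h3
    simp [h3, h2]

lemma vecMul_configMatY_injective {i j : Fin n} (hxy : p i 0 * p j 1 - p j 0 * p i 1 ≠ 0)
    (hz : p i 2 ≠ p j 2) {c : Fin 6 → ℝ} (hc : c ᵥ* configMatY p = 0) : c = 0 := by
  have hi := vecMul_configMatY p c i
  have hj := vecMul_configMatY p c j
  simp only [hc, Pi.zero_apply] at hi hj
  obtain ⟨hi0, hi1, hi2⟩ := hi
  obtain ⟨hj0, hj1, hj2⟩ := hj
  have hz' := sub_ne_zero.2 hz
  have c2 : c 2 = 0 := mul_right_cancel₀ hz' (by linear_combination hj2 - hi2)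
  funext a
  fin_cases a
  · change c 0 = 0
    exact mul_right_cancel₀ hxy (by linear_combination p i 1 * hj0 - p j 1 * hi0)
  · change c 1 = 0
    exact mul_right_cancel₀ hxy (by linear_combination p j 0 * hi1 - p i 0 * hj1)
  · exact c2
  · change c 3 = 0
    exact mul_right_cancel₀ hxy (by linear_combination p j 0 * hi0 - p i 0 * hj0)
  · change c 4 = 0
    exact mul_right_cancel₀ hxy (by linear_combination p i 1 * hj1 - p j 1 * hi1)
  · simp; linear_combination -hi2 - c2 * p i 2

lemma six_le_finrank_ker_stressMatY (hω : ∀ i, ω i i = 0) (h : IsEquilStressY p ω lam)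
    {i j : Fin n} (hxy : p i 0 * p j 1 - p j 0 * p i 1 ≠ 0) (hz : p i 2 ≠ p j 2) :
    6 ≤ finrank ℝ (LinearMap.ker (stressMatY ω lam).mulVecLin) := by
  have h := finrank_le_finrank_of_injOn (K := (⊤ : Submodule ℝ (Fin 6 → ℝ)))
    (K' := LinearMap.ker (stressMatY ω lam).mulVecLin) (configMatY p).vecMulLinear
    (fun c _ => stressMatY_mulVec_vecMul_configMatY hω h c)
    (fun c _ hc => vecMul_configMatY_injective hxy hz hc)
  simpa using h

lemma exists_eq_vecMul_configMatY (hω : ∀ i, ω i i = 0) (h : IsEquilStressY p ω lam)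
    {i j : Fin n} (hxy : p i 0 * p j 1 - p j 0 * p i 1 ≠ 0) (hz : p i 2 ≠ p j 2)
    (hker : finrank ℝ (LinearMap.ker (stressMatY ω lam).mulVecLin) ≤ 6)
    {u : Fin 3 × Fin n → ℝ} (hu : stressMatY ω lam *ᵥ u = 0) :
    ∃ c, c ᵥ* configMatY p = u := by
  have hle : LinearMap.range (configMatY p).vecMulLinear ≤
      LinearMap.ker (stressMatY ω lam).mulVecLin := by
    rintro _ ⟨c, rfl⟩
    exact stressMatY_mulVec_vecMul_configMatY hω h c
  have heq := Submodule.eq_of_le_of_finrank_le hle (hker.trans (by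
    rw [LinearMap.finrank_range_of_inj]
    · simp
    · rw [← LinearMap.ker_eq_bot, LinearMap.ker_eq_bot']
      exact fun c hc => vecMul_configMatY_injective hxy hz hc))
  have hmem : u ∈ LinearMap.ker (stressMatY ω lam).mulVecLin := hu
  rw [← heq] at hmem
  exact hmem

/-- A configuration-type motion that is an infinitesimal motion of a framework with at least one
edge preserves all pairwise distances to first order. -/
lemma sum_eq_zero_of_isInfMotion_vecMul_configMatY {H : SimpleGraph (Fin n)} {c : Fin 6 → ℝ}
    (hm : IsInfMotion H (fun d => p d.2 d.1) (c ᵥ* configMatY p)) {i j k : Fin n}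
    (hij : p i 0 * p j 1 - p j 0 * p i 1 ≠ 0) (hik : p i 0 * p k 1 - p k 0 * p i 1 ≠ 0)
    (hjk : p j 0 * p k 1 - p k 0 * p j 1 ≠ 0) {s t : Fin n} (hst : H.Adj s t)
    (hz : p s 2 ≠ p t 2) (i' j' : Fin n) :
    ∑ a, (p i' a - p j' a) * ((c ᵥ* configMatY p) (a, i') - (c ᵥ* configMatY p) (a, j')) = 0 := by
  obtain ⟨hedge, hcyl⟩ := hm
  have hQ : ∀ l, c 0 * p l 0 ^ 2 + (c 3 + c 4) * (p l 0 * p l 1) + c 1 * p l 1 ^ 2 = 0 := by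
    intro l
    have h := hcyl l
    simp only [(vecMul_configMatY p c l).1, (vecMul_configMatY p c l).2.1] at h
    linear_combination h
  have hdet := mul_ne_zero (mul_ne_zero hij hik) hjk
  have hi := hQ i
  have hj := hQ j
  have hk := hQ k
  set dij := p i 0 * p j 1 - p j 0 * p i 1 with hdij
  set dik := p i 0 * p k 1 - p k 0 * p i 1 with hdik
  set djk := p j 0 * p k 1 - p k 0 * p j 1 with hdjk
  have c0 : c 0 = 0 := by
    refine mul_right_cancel₀ hdet ?_
    linear_combination p j 1 * p k 1 * djk * hi - p i 1 * p k 1 * dik * hj +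
      p i 1 * p j 1 * dij * hk
  have c1 : c 1 = 0 := by
    refine mul_right_cancel₀ hdet ?_
    linear_combination p j 0 * p k 0 * djk * hi - p i 0 * p k 0 * dik * hj +
      p i 0 * p j 0 * dij * hk
  have c34 : c 3 + c 4 = 0 := by
    refine mul_right_cancel₀ hdet ?_
    linear_combination -(p j 0 * p k 1 + p k 0 * p j 1) * djk * hi +
      (p i 0 * p k 1 + p k 0 * p i 1) * dik * hj - (p i 0 * p j 1 + p j 0 * p i 1) * dij * hk
  have hsum : ∀ s t, ∑ a, (p s a - p t a) *
      ((c ᵥ* configMatY p) (a, s) - (c ᵥ* configMatY p) (a, t)) = c 2 * (p s 2 - p t 2) ^ 2 := by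
    intro s t
    simp only [Fin.sum_univ_three, (vecMul_configMatY p c _).1, (vecMul_configMatY p c _).2.1,
      (vecMul_configMatY p c _).2.2]
    linear_combination (p s 0 - p t 0) ^ 2 * c0 + (p s 1 - p t 1) ^ 2 * c1 +
      (p s 0 - p t 0) * (p s 1 - p t 1) * c34
  have h := hedge s t hst
  rw [hsum] at h
  have hc2 : c 2 = 0 := (mul_eq_zero.1 h).resolve_right (pow_ne_zero 2 (sub_ne_zero.2 hz))
  rw [hsum, hc2, zero_mul]

end Config

section NonzeroStress

variable {p : Fin 3 × Fin n → ℝ}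

/-- Small perturbations do not increase the nullity of the stress matrix. -/
lemma exists_ne_zero_finrank_ker_stressMatY_le (G : SimpleGraph (Fin n))
    (w w' : (Fin n × Fin n) ⊕ Fin n → ℝ) :
    ∃ t : ℝ, t ≠ 0 ∧ finrank ℝ (LinearMap.ker (stressMatY (edgeStress G (w + t • w'))
        fun i => (w + t • w') (Sum.inr i)).mulVecLin) ≤
      finrank ℝ (LinearMap.ker (stressMatY (edgeStress G w) fun i => w (Sum.inr i)).mulVecLin) := by
  obtain ⟨D, hD⟩ := exists_det_gramSum_ne_zero
    (stressMatY (edgeStress G w) fun i => w (Sum.inr i)) le_rfl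
  have hS : Continuous fun w : (Fin n × Fin n) ⊕ Fin n → ℝ =>
      stressMatY (edgeStress G w) fun i => w (Sum.inr i) :=
    continuous_matrix fun r c => (ratPoly_stressMatY G r c).continuous
  have hdet : Continuous fun t : ℝ => (gramSum (stressMatY (edgeStress G (w + t • w'))
      fun i => (w + t • w') (Sum.inr i)) D).det := by
    have hS' : Continuous fun t : ℝ => stressMatY (edgeStress G (w + t • w'))
      fun i => (w + t • w') (Sum.inr i) := hS.comp (g := fun w : (Fin n × Fin n) ⊕ Fin n → ℝ =>
        stressMatY (edgeStress G w) fun i => w (Sum.inr i)) (f := fun t : ℝ => w + t • w')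
        (by fun_prop)
    unfold gramSum
    fun_prop
  have hne : ∀ᶠ t in nhds (0 : ℝ), (gramSum (stressMatY (edgeStress G (w + t • w'))
      fun i => (w + t • w') (Sum.inr i)) D).det ≠ 0 :=
    hdet.continuousAt.eventually_ne (by simpa using hD)
  obtain ⟨t, ht, ht0⟩ := ((hne.filter_mono (nhdsWithin_le_nhds (s := {0}ᶜ))).and
    eventually_mem_nhdsWithin).exists
  exact ⟨t, ht0, finrank_ker_le_of_det_gramSum_ne_zero _ _ ht⟩

lemma exists_vecMul_eq_of_forall_ker {m N : Type*} [Fintype m] [Fintype N]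
    (A : Matrix m N ℝ) (b : N → ℝ) (h : ∀ v, A *ᵥ v = 0 → b ⬝ᵥ v = 0) :
    ∃ w, w ᵥ* A = b := by
  classical
  have hmem : dotProductBilin ℝ ℝ b ∈ (LinearMap.ker A.mulVecLin).dualAnnihilator := by
    rw [Submodule.mem_dualAnnihilator]
    exact fun v hv => h v hv
  rw [← LinearMap.range_dualMap_eq_dualAnnihilator_ker] at hmem
  obtain ⟨φ, hφ⟩ := hmem
  refine ⟨fun i => φ (Pi.single i 1), ?_⟩
  have hφ' : ∀ x, φ x = (fun i => φ (Pi.single i 1)) ⬝ᵥ x := by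
    intro x
    rw [LinearMap.pi_apply_eq_sum_univ φ x]
    simp only [dotProduct, smul_eq_mul]
    refine Finset.sum_congr rfl fun i _ => ?_
    rw [mul_comm]
    congr 2
    funext j
    simp [Pi.single_apply, eq_comm]
  funext c
  have h1 := LinearMap.congr_fun hφ (Pi.single c 1)
  rw [LinearMap.dualMap_apply, mulVecLin_apply, hφ', dotProduct_mulVec] at h1
  simpa using h1

/-- At a generic configuration, an equilibrium stress annihilates every infinitesimal motion. -/
lemma vecMul_rigMat_eq_zero_of_isInfMotion (H : SimpleGraph (Fin n))
    (hp : AlgebraicIndependent ℚ p) {w : (Fin n × Fin n) ⊕ Fin n → ℝ}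
    (hw : w ᵥ* rigMat H p = 0) {m : Fin 3 × Fin n → ℝ} (hm : rigMat H p *ᵥ m = 0) :
    w ᵥ* rigMat H m = 0 := by
  rw [← dotProduct_eq_zero_iff]
  intro u
  rw [← dotProduct_mulVec, rigMat_mulVec_comm]
  refine dotProduct_mulVec_eq_zero_of_finrank_ker_le (rigMat H p) (rigMat H u) (fun t => ?_) hw hm
  rw [← rigMat_add_smul]
  exact finrank_ker_le_of_algebraicIndependent (ratPoly_rigMat H) hp _

lemma exists_vecMul_rigMat_eq_zero_of_deleteEdges (G : SimpleGraph (Fin n)) {i j : Fin n}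
    (hij : G.Adj i j) {w : (Fin n × Fin n) ⊕ Fin n → ℝ}
    (hw : w ᵥ* rigMat (G.deleteEdges {s(i, j)}) p = rigMat G p (Sum.inl (i, j))) :
    ∃ w', w' ᵥ* rigMat G p = 0 ∧ edgeStress G w' i j = -1 := by
  classical
  refine ⟨Sum.elim (fun e => if (G.deleteEdges {s(i, j)}).Adj e.1 e.2 then w (Sum.inl e) else
    if e = (i, j) then -1 else 0) fun k => w (Sum.inr k), ?_, ?_⟩
  · funext c
    have hc := congrFun hw c
    have hterm : ∀ e : Fin n × Fin n,
        (if (G.deleteEdges {s(i, j)}).Adj e.1 e.2 then w (Sum.inl e) else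
          if e = (i, j) then -1 else 0) * rigMat G p (Sum.inl e) c =
        w (Sum.inl e) * rigMat (G.deleteEdges {s(i, j)}) p (Sum.inl e) c -
          if e = (i, j) then rigMat G p (Sum.inl e) c else 0 := by
      intro e
      by_cases he : (G.deleteEdges {s(i, j)}).Adj e.1 e.2
      · have h1 := SimpleGraph.deleteEdges_adj.1 he
        have h2 : e ≠ (i, j) := by
          rintro rfl
          exact h1.2 rfl
        simp only [rigMat, he, h1.1, if_true, h2, if_false, sub_zero]
      · simp only [rigMat, he, if_false]
        split_ifs <;> ring
    simp only [vecMul, dotProduct, Fintype.sum_sum_type, Sum.elim_inl, Sum.elim_inr, hterm,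
      Finset.sum_sub_distrib, Finset.sum_ite_eq', Finset.mem_univ, if_true] at hc ⊢
    rw [← hc]
    simp only [Pi.zero_apply]
    have hinr : ∀ k, rigMat (G.deleteEdges {s(i, j)}) p (Sum.inr k) c =
      rigMat G p (Sum.inr k) c := fun k => rfl
    simp only [hinr]
    ring
  · have h1 : (j, i) ≠ (i, j) := fun h => hij.ne (congrArg Prod.snd h)
    simp [edgeStress, hij, h1]

/-- At a generic configuration, a stress whose stress matrix has minimal nullity can be chosen
to be nonzero on any prescribed edge. -/
lemma exists_stress_ne_zero (G : SimpleGraph (Fin n)) (hp : AlgebraicIndependent ℚ p)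
    {i j k : Fin n} (hij : G.Adj i j) (hki : k ≠ i) (hkj : k ≠ j)
    {w : (Fin n × Fin n) ⊕ Fin n → ℝ} (hw : w ᵥ* rigMat G p = 0)
    (hker : finrank ℝ (LinearMap.ker
      (stressMatY (edgeStress G w) fun i => w (Sum.inr i)).mulVecLin) ≤ 6) :
    ∃ w', w' ᵥ* rigMat G p = 0 ∧ finrank ℝ (LinearMap.ker
      (stressMatY (edgeStress G w') fun i => w' (Sum.inr i)).mulVecLin) ≤ 6 ∧
      edgeStress G w' i j ≠ 0 := by
  classical
  by_cases h0 : edgeStress G w i j = 0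
  swap
  · exact ⟨w, hw, hker, h0⟩
  set H := G.deleteEdges {s(i, j)} with hH
  have hsG := isStress_edgeStress G w
  have hsH : IsStress H (edgeStress G w) := by
    refine ⟨hsG.1, fun a b hab => ?_⟩
    by_cases hG : G.Adj a b
    · have hs : s(a, b) = s(i, j) := by
        by_contra hs
        exact hab (SimpleGraph.deleteEdges_adj.2 ⟨hG, hs⟩)
      rcases Sym2.eq_iff.1 hs with ⟨rfl, rfl⟩ | ⟨rfl, rfl⟩
      · exact h0
      · rw [hsG.1, h0]
    · exact hsG.2 a b hG
  obtain ⟨wH, hwH, hlam⟩ := exists_edgeStress_eq hsH fun i => w (Sum.inr i)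
  have hequil := (vecMul_rigMat_eq_zero_iff G p w).1 hw
  have hwH0 : wH ᵥ* rigMat H p = 0 := by
    rw [vecMul_rigMat_eq_zero_iff, hwH, hlam]
    exact hequil
  have hdiag : ∀ i, edgeStress G w i i = 0 := fun i => hsG.2 i i G.irrefl
  have hz : ∀ {a b : Fin n}, a ≠ b → p (2, a) ≠ p (2, b) := fun hab =>
    ne_of_algebraicIndependent hp (by simpa using hab)
  have hconf : ∀ u, stressMatY (edgeStress G w) (fun i => w (Sum.inr i)) *ᵥ u = 0 →
      ∃ c, c ᵥ* configMatY (fun i a => p (a, i)) = u := fun u hu =>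
    exists_eq_vecMul_configMatY hdiag hequil (cross_ne_zero_of_algebraicIndependent hp hij.ne)
      (hz hij.ne) hker hu
  obtain ⟨s, t, hst⟩ : ∃ s t, H.Adj s t := by
    by_contra! hno
    have hω : edgeStress G w = fun _ _ => 0 := by
      funext a b
      exact hsH.2 a b (hno a b)
    obtain ⟨c, hc⟩ := hconf (Pi.single (2, i) 1) (by
      funext ⟨a, b⟩
      rw [stressMatY_mulVec hdiag, hω]
      by_cases ha : a = 2 <;> simp [ha, Pi.single_apply])
    have hi := (vecMul_configMatY (fun i a => p (a, i)) c i).2.2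
    have hj := (vecMul_configMatY (fun i a => p (a, i)) c j).2.2
    have hk := (vecMul_configMatY (fun i a => p (a, i)) c k).2.2
    simp only [hc, Pi.single_apply, Prod.mk.injEq, true_and, hij.ne.symm, hki, if_true,
      if_false] at hi hj hk
    have hc2 : c 2 = 0 := mul_right_cancel₀ (sub_ne_zero.2 (hz hkj)) (by linear_combination hj - hk)
    rw [hc2] at hi hj
    linarith
  obtain ⟨v, hv⟩ := exists_vecMul_eq_of_forall_ker (rigMat H p) (rigMat G p (Sum.inl (i, j)))
    fun m hm => by
      have h1 := vecMul_rigMat_eq_zero_of_isInfMotion H hp hwH0 hm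
      rw [← stressMatY_mulVec_edgeStress, hwH, hlam] at h1
      obtain ⟨c, rfl⟩ := hconf m h1
      change (rigMat G p *ᵥ _) (Sum.inl (i, j)) = 0
      rw [rigMat_mulVec_inl G p _ hij]
      exact sum_eq_zero_of_isInfMotion_vecMul_configMatY (p := fun i a => p (a, i))
        ((rigMat_mulVec_eq_zero_iff H p _).1 hm)
        (cross_ne_zero_of_algebraicIndependent hp hij.ne)
        (cross_ne_zero_of_algebraicIndependent hp hki.symm)
        (cross_ne_zero_of_algebraicIndependent hp hkj.symm) hst (hz hst.ne) i j
  obtain ⟨w', hw', hw'ij⟩ := exists_vecMul_rigMat_eq_zero_of_deleteEdges G hij hv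
  obtain ⟨t, ht, hle⟩ := exists_ne_zero_finrank_ker_stressMatY_le G w w'
  refine ⟨w + t • w', by rw [add_vecMul, smul_vecMul, hw, hw', smul_zero, add_zero],
    hle.trans hker, ?_⟩
  have hlin : edgeStress G (w + t • w') i j = edgeStress G w i j + t * edgeStress G w' i j := by
    simp only [edgeStress, hij, if_true, Pi.add_apply, Pi.smul_apply, smul_eq_mul]
    ring
  rw [hlin, h0, hw'ij]
  simpa using ht

end NonzeroStress

section OneExtension

variable {p : Fin 3 × Fin n → ℝ} {G : SimpleGraph (Fin n)} {G' : SimpleGraph (Fin (n + 1))}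
  {i₁ i₂ i₃ : Fin n}

/-- The configuration extending `p` by a new vertex at the midpoint of `i` and `j`. -/
noncomputable def midpointExt (p : Fin 3 × Fin n → ℝ) (i j : Fin n) : Fin 3 × Fin (n + 1) → ℝ :=
  fun c => Fin.cases ((p (c.1, i) + p (c.1, j)) / 2) (fun k => p (c.1, k)) c.2

/-- The edge stress on the 1-extension at a midpoint configuration: the stress `ω i j` of the
deleted edge is replaced by the stress `2 * ω i j` on both halves of the subdivided edge. -/
noncomputable def subdivStress (ω : Fin n → Fin n → ℝ) (i j : Fin n) :
    Fin (n + 1) → Fin (n + 1) → ℝ :=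
  fun s t => Fin.cases
    (Fin.cases 0 (fun l => (if l = i then 2 * ω i j else 0) + if l = j then 2 * ω i j else 0) t)
    (fun k => Fin.cases ((if k = i then 2 * ω i j else 0) + if k = j then 2 * ω i j else 0)
      (fun l => ω k l - (if k = i then if l = j then ω i j else 0 else 0) -
        if k = j then if l = i then ω i j else 0 else 0) t) s

lemma sum_subdivStress_zero (ω : Fin n → Fin n → ℝ) (i j : Fin n) (f : Fin (n + 1) → ℝ) :
    ∑ t, subdivStress ω i j 0 t * (f 0 - f t) =
      2 * ω i j * (2 * f 0 - f i.succ - f j.succ) := by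
  simp [Fin.sum_univ_succ, subdivStress, add_mul, Finset.sum_add_distrib]
  ring

lemma sum_subdivStress_succ (ω : Fin n → Fin n → ℝ) {i j : Fin n} (hij : i ≠ j)
    (f : Fin (n + 1) → ℝ)
    (hf : 2 * f 0 = f i.succ + f j.succ) (k : Fin n) :
    ∑ t, subdivStress ω i j k.succ t * (f k.succ - f t) =
      ∑ l, ω k l * (f k.succ - f l.succ) := by
  simp only [Fin.sum_univ_succ, subdivStress, Fin.cases_zero, Fin.cases_succ, sub_mul,
    Finset.sum_sub_distrib]
  by_cases hi : k = i
  · subst hi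
    simp [hij]
    linear_combination -(ω k j * hf)
  · by_cases hj : k = j
    · subst hj
      simp [hi]
      linear_combination -(ω i k * hf)
    · simp [hi, hj]

lemma isStress_subdivStress (hext : IsOneExtension G G' i₁ i₂ i₃) {ω : Fin n → Fin n → ℝ}
    (hω : IsStress G ω) : IsStress G' (subdivStress ω i₁ i₂) := by
  obtain ⟨h12, -, -, hold, hnew⟩ := hext
  have hne := h12.ne
  constructor
  · intro s t
    refine Fin.cases ?_ (fun k => ?_) s <;> refine Fin.cases ?_ (fun l => ?_) t
    · rfl
    · rfl
    · rfl
    · simp only [subdivStress, Fin.cases_succ, hω.1 k l]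
      split_ifs <;> ring
  · intro s t
    refine Fin.cases ?_ (fun k => ?_) s <;> refine Fin.cases ?_ (fun l => ?_) t <;> intro h
    · rfl
    · rw [hnew] at h
      push Not at h
      simp [subdivStress, h.1, h.2.1]
    · rw [G'.adj_comm, hnew] at h
      push Not at h
      simp [subdivStress, h.1, h.2.1]
    · rw [hold] at h
      simp only [subdivStress, Fin.cases_succ]
      by_cases hG : G.Adj k l
      · have h' : (k = i₁ ∧ l = i₂) ∨ (k = i₂ ∧ l = i₁) := by
          by_contra h'
          exact h ⟨hG, h'⟩
        rcases h' with ⟨rfl, rfl⟩ | ⟨rfl, rfl⟩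
        · simp [hne]
        · simp [hne, hω.1 k l]
      · have h1 : ¬ (k = i₁ ∧ l = i₂) := by
          rintro ⟨rfl, rfl⟩
          exact hG h12
        have h2 : ¬ (k = i₂ ∧ l = i₁) := by
          rintro ⟨rfl, rfl⟩
          exact hG h12.symm
        rw [hω.2 k l hG]
        simp only [← ite_and, h1, h2, if_false, sub_zero]

lemma isEquilStressY_subdivStress {p : Fin 3 × Fin n → ℝ} {i j : Fin n} (hij : i ≠ j)
    {ω : Fin n → Fin n → ℝ} {lam : Fin n → ℝ} (h : IsEquilStressY (fun i a => p (a, i)) ω lam) :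
    IsEquilStressY (fun k a => midpointExt p i j (a, k)) (subdivStress ω i j)
      (Fin.cases 0 lam) := by
  intro s a
  have hmid : 2 * midpointExt p i j (a, 0) =
      midpointExt p i j (a, i.succ) + midpointExt p i j (a, j.succ) := by
    simp only [midpointExt, Fin.cases_zero, Fin.cases_succ]
    ring
  refine Fin.cases ?_ (fun k => ?_) s
  · rw [sum_subdivStress_zero ω i j fun k => midpointExt p i j (a, k)]
    simp only [Fin.cases_zero]
    linear_combination 2 * ω i j * hmid
  · rw [sum_subdivStress_succ ω hij (fun k => midpointExt p i j (a, k)) hmid]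
    exact h k a

/-- Restriction of a motion of the extended framework to the old vertices. -/
def restrictOld (n : ℕ) : (Fin 3 × Fin (n + 1) → ℝ) →ₗ[ℝ] (Fin 3 × Fin n → ℝ) :=
  LinearMap.funLeft ℝ ℝ fun c => (c.1, c.2.succ)

lemma eq_zero_of_restrictOld_eq_zero {u : Fin 3 × Fin (n + 1) → ℝ} (hu : restrictOld n u = 0)
    (h0 : ∀ a, u (a, 0) = 0) : u = 0 := by
  funext ⟨a, s⟩
  refine Fin.cases (h0 a) (fun k => ?_) s
  exact congrFun hu (a, k)

lemma finrank_ker_stressMatY_subdivStress_le {i j : Fin n} (hij : i ≠ j)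
    {ω : Fin n → Fin n → ℝ} (hdiag : ∀ k, ω k k = 0) (hω : ω i j ≠ 0) (lam : Fin n → ℝ) :
    finrank ℝ (LinearMap.ker (stressMatY (subdivStress ω i j) (Fin.cases 0 lam)).mulVecLin) ≤
      finrank ℝ (LinearMap.ker (stressMatY ω lam).mulVecLin) := by
  have hdiag' : ∀ k, subdivStress ω i j k k = 0 := by
    intro k
    refine Fin.cases rfl (fun l => ?_) k
    simp only [subdivStress, Fin.cases_succ, hdiag]
    split_ifs <;> simp_all
  have hmid : ∀ u, stressMatY (subdivStress ω i j) (Fin.cases 0 lam) *ᵥ u = 0 → ∀ a,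
      2 * u (a, 0) = u (a, i.succ) + u (a, j.succ) := by
    intro u hu a
    have h := congrFun hu (a, 0)
    rw [stressMatY_mulVec hdiag', sum_subdivStress_zero ω i j fun k => u (a, k)] at h
    simp only [Fin.cases_zero, zero_mul, add_zero, Pi.zero_apply] at h
    have h' := (mul_eq_zero.1 h).resolve_left (mul_ne_zero two_ne_zero hω)
    linear_combination h'
  refine finrank_le_finrank_of_injOn (restrictOld n) (fun u hu => ?_) fun u hu hu0 => ?_
  · change stressMatY ω lam *ᵥ _ = 0
    funext ⟨a, k⟩
    have h := congrFun hu (a, k.succ)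
    rw [mulVecLin_apply, stressMatY_mulVec hdiag',
      sum_subdivStress_succ ω hij (fun k => u (a, k)) (hmid u hu a)] at h
    rw [stressMatY_mulVec hdiag]
    exact h
  · refine eq_zero_of_restrictOld_eq_zero hu0 fun a => ?_
    have h := hmid u hu a
    have hi : u (a, i.succ) = 0 := congrFun hu0 (a, i)
    have hj : u (a, j.succ) = 0 := congrFun hu0 (a, j)
    rw [hi, hj] at h
    linarith

lemma finrank_ker_rigMat_midpointExt_le (hext : IsOneExtension G G' i₁ i₂ i₃)
    (hp : AlgebraicIndependent ℚ p) :
    finrank ℝ (LinearMap.ker (rigMat G' (midpointExt p i₁ i₂)).mulVecLin) ≤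
      finrank ℝ (LinearMap.ker (rigMat G p).mulVecLin) := by
  obtain ⟨h12, h31, h32, hold, hnew⟩ := hext
  refine finrank_le_finrank_of_injOn (restrictOld n) (fun u hu => ?_) fun u hu hu0 => ?_
  · rw [LinearMap.mem_ker, mulVecLin_apply, rigMat_mulVec_eq_zero_iff] at hu ⊢
    obtain ⟨hedge, hcyl⟩ := hu
    have key : ∑ a, (p (a, i₁) - p (a, i₂)) * (u (a, i₁.succ) - u (a, i₂.succ)) = 0 := by
      have h1 := hedge 0 i₁.succ ((hnew i₁).2 (.inl rfl))
      have h2 := hedge 0 i₂.succ ((hnew i₂).2 (.inr (.inl rfl)))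
      simp only [midpointExt, Fin.cases_zero, Fin.cases_succ, Fin.sum_univ_three] at h1 h2 ⊢
      linear_combination 2 * h2 + 2 * h1
    refine ⟨fun k l hkl => ?_, fun k => hcyl k.succ⟩
    by_cases h : (k = i₁ ∧ l = i₂) ∨ (k = i₂ ∧ l = i₁)
    · rcases h with ⟨rfl, rfl⟩ | ⟨rfl, rfl⟩
      · exact key
      · rw [← key]
        refine Finset.sum_congr rfl fun a _ => ?_
        change _ * (u (a, k.succ) - u (a, l.succ)) = _
        ring
    · exact hedge k.succ l.succ ((hold k l).2 ⟨hkl, h⟩)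
  · refine eq_zero_of_restrictOld_eq_zero hu0 ?_
    rw [LinearMap.mem_ker, mulVecLin_apply, rigMat_mulVec_eq_zero_iff] at hu
    obtain ⟨hedge, hcyl⟩ := hu
    have hz : ∀ (a : Fin 3) (k : Fin n), u (a, k.succ) = 0 := fun a k => congrFun hu0 (a, k)
    have h1 := hedge 0 i₁.succ ((hnew i₁).2 (.inl rfl))
    have h3 := hedge 0 i₃.succ ((hnew i₃).2 (.inr (.inr rfl)))
    have h0 := hcyl 0
    simp only [midpointExt, Fin.cases_zero, Fin.cases_succ, Fin.sum_univ_three, hz, sub_zero]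
      at h0 h1 h3
    have hdet := attach_det_ne_zero_of_algebraicIndependent hp h12.ne h31 h32
    set X := p (0, i₁) + p (0, i₂) with hX
    set Y := p (1, i₁) + p (1, i₂) with hY
    set dx := p (0, i₁) - p (0, i₂) with hdx
    set dy := p (1, i₁) - p (1, i₂) with hdy
    set dz := p (2, i₁) - p (2, i₂) with hdz
    set ex := X - 2 * p (0, i₃) with hex
    set ey := Y - 2 * p (1, i₃) with hey
    set ez := p (2, i₁) + p (2, i₂) - 2 * p (2, i₃) with hez
    have e0 : X * u (0, 0) + Y * u (1, 0) = 0 := by linear_combination 2 * h0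
    have e1 : dx * u (0, 0) + dy * u (1, 0) + dz * u (2, 0) = 0 := by linear_combination -2 * h1
    have e3 : ex * u (0, 0) + ey * u (1, 0) + ez * u (2, 0) = 0 := by linear_combination 2 * h3
    clear_value X Y dx dy dz ex ey ez
    intro a
    fin_cases a
    · refine (mul_eq_zero.1 ?_).resolve_left hdet
      simp only [Fin.zero_eta]
      linear_combination (dy * ez - dz * ey) * e0 - Y * ez * e1 + Y * dz * e3
    · refine (mul_eq_zero.1 ?_).resolve_left hdet
      simp only [Fin.mk_one]
      linear_combination -(dx * ez - dz * ex) * e0 + X * ez * e1 - X * dz * e3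
    · refine (mul_eq_zero.1 ?_).resolve_left hdet
      simp only [Fin.reduceFinMk]
      linear_combination (dx * ey - dy * ex) * e0 + (Y * ex - X * ey) * e1 + (X * dy - Y * dx) * e3

/-- If some configuration of `G` has minimal nullity `2` and a stress of nullity at most `6`, then
every generic configuration of a 1-extension `G'` has these properties. -/
lemma exists_stress_of_isOneExtension (hext : IsOneExtension G G' i₁ i₂ i₃)
    {p : Fin 3 × Fin n → ℝ} (hp : finrank ℝ (LinearMap.ker (rigMat G p).mulVecLin) ≤ 2)
    {w : (Fin n × Fin n) ⊕ Fin n → ℝ} (hw : w ᵥ* rigMat G p = 0)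
    (hker : finrank ℝ (LinearMap.ker
      (stressMatY (edgeStress G w) fun i => w (Sum.inr i)).mulVecLin) ≤ 6)
    {q : Fin 3 × Fin (n + 1) → ℝ} (hq : AlgebraicIndependent ℚ q) :
    finrank ℝ (LinearMap.ker (rigMat G' q).mulVecLin) = 2 ∧
      ∃ w', w' ᵥ* rigMat G' q = 0 ∧ finrank ℝ (LinearMap.ker
        (stressMatY (edgeStress G' w') fun i => w' (Sum.inr i)).mulVecLin) ≤ 6 := by
  set q₀ : Fin 3 × Fin n → ℝ := fun c => q (c.1, c.2.succ) with hq₀def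
  have hq₀ : AlgebraicIndependent ℚ q₀ := hq.comp (fun c : Fin 3 × Fin n => (c.1, c.2.succ))
    fun c d h => by simpa [Prod.ext_iff] using h
  obtain ⟨w₀, hw₀, hker₀⟩ := exists_left_kernel_of_algebraicIndependent (ratPoly_rigMat G)
    (ratPoly_stressMatY G) hq₀ (hp.trans (two_le_finrank_ker_rigMat G (hq₀.ne_zero (0, i₁)))) hw
  obtain ⟨w₁, hw₁, hker₁, hne⟩ := exists_stress_ne_zero G hq₀ hext.1 hext.2.1 hext.2.2.1 hw₀
    (hker₀.trans hker)
  have hs := isStress_edgeStress G w₁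
  obtain ⟨w₂, hw₂, hlam₂⟩ := exists_edgeStress_eq (isStress_subdivStress hext hs)
    (Fin.cases 0 fun i => w₁ (Sum.inr i))
  have hw₂0 : w₂ ᵥ* rigMat G' (midpointExt q₀ i₁ i₂) = 0 := by
    rw [vecMul_rigMat_eq_zero_iff, hw₂, hlam₂]
    exact isEquilStressY_subdivStress hext.1.ne ((vecMul_rigMat_eq_zero_iff G q₀ w₁).1 hw₁)
  have hker₂ := finrank_ker_stressMatY_subdivStress_le hext.1.ne
    (fun k => hs.2 k k G.irrefl) hne fun i => w₁ (Sum.inr i)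
  rw [← hw₂, ← hlam₂] at hker₂
  have hmid : finrank ℝ (LinearMap.ker (rigMat G' (midpointExt q₀ i₁ i₂)).mulVecLin) ≤ 2 :=
    (finrank_ker_rigMat_midpointExt_le hext hq₀).trans
      ((finrank_ker_le_of_algebraicIndependent (ratPoly_rigMat G) hq₀ p).trans hp)
  have htwo := two_le_finrank_ker_rigMat G' (hq.ne_zero (0, 0))
  obtain ⟨w', hw', hker'⟩ := exists_left_kernel_of_algebraicIndependent (ratPoly_rigMat G')
    (ratPoly_stressMatY G') hq (hmid.trans htwo) hw₂0
  exact ⟨le_antisymm ((finrank_ker_le_of_algebraicIndependent (ratPoly_rigMat G') hq _).trans hmid)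
    htwo, w', hw', hker'.trans (hker₂.trans hker₁)⟩

end OneExtension

end Framework

theorem stmt17 (n : ℕ) (G : SimpleGraph (Fin n)) [DecidableRel G.Adj]
    (r : Fin n → ℝ) (hr : ∀ i, 0 < r i)
    (p : Fin n → Fin 3 → ℝ) (hp : ∀ i, (p i 0) ^ 2 + (p i 1) ^ 2 = r i)
    (hrig : (rigidityMatY G p).rank = 3 * n - 2)
    (ω : Fin n → Fin n → ℝ) (lam : Fin n → ℝ) (hω : IsStress G ω)
    (hequil : IsEquilStressY p ω lam)
    (hrank : (stressMatY ω lam).rank = 3 * n - 6)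
    (G' : SimpleGraph (Fin (n + 1))) [DecidableRel G'.Adj]
    (i1 i2 i3 : Fin n) (hext : IsOneExtension G G' i1 i2 i3)
    (q : Fin (n + 1) → Fin 3 → ℝ)
    (hgen : AlgebraicIndependent ℚ (fun c : Fin (n + 1) × Fin 3 => q c.1 c.2)) :
    (rigidityMatY G' q).rank = 3 * (n + 1) - 2 ∧
    ∃ (ω' : Fin (n + 1) → Fin (n + 1) → ℝ) (lam' : Fin (n + 1) → ℝ),
      IsStress G' ω' ∧ IsEquilStressY q ω' lam' ∧
      (stressMatY ω' lam').rank = 3 * (n + 1) - 6 := by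
  have hn : 3 ≤ n := by
    have hcard : ({i1, i2, i3} : Finset (Fin n)).card = 3 :=
      Finset.card_eq_three.2 ⟨i1, i2, i3, hext.1.ne, hext.2.1.symm, hext.2.2.1.symm, rfl⟩
    simpa [hcard] using Finset.card_le_univ ({i1, i2, i3} : Finset (Fin n))
  have hrigker := rank_rigidityMatY_add_finrank_ker_rigMat G p
  have hstressker := rank_add_finrank_ker (stressMatY ω lam)
  rw [Fintype.card_prod, Fintype.card_fin, Fintype.card_fin] at hstressker
  obtain ⟨w, hw, hlam⟩ := exists_edgeStress_eq hω lam
  have hgen' : AlgebraicIndependent ℚ fun c : Fin 3 × Fin (n + 1) => q c.2 c.1 :=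
    hgen.comp Prod.swap Prod.swap_injective
  obtain ⟨hker2, w', hw', hker6⟩ := exists_stress_of_isOneExtension hext
    (p := fun c => p c.2 c.1) (by omega) (w := w)
    (by rw [vecMul_rigMat_eq_zero_iff, hw, hlam]; exact hequil)
    (by rw [hw, hlam]; omega) hgen'
  have hequil' := (vecMul_rigMat_eq_zero_iff G' _ w').1 hw'
  have hs' := isStress_edgeStress G' w'
  refine ⟨?_, _, _, hs', hequil', ?_⟩
  · have h := rank_rigidityMatY_add_finrank_ker_rigMat G' q
    omega
  · have h := rank_add_finrank_ker (stressMatY (edgeStress G' w') fun i => w' (Sum.inr i))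
    rw [Fintype.card_prod, Fintype.card_fin, Fintype.card_fin] at h
    have h6 := six_le_finrank_ker_stressMatY (fun k => hs'.2 k k G'.irrefl) hequil'
      (cross_ne_zero_of_algebraicIndependent hgen' (Fin.succ_ne_zero i1))
      (ne_of_algebraicIndependent hgen' (c := (2, i1.succ)) (d := (2, 0)) (by simp))
    omega
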